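/- Let K ≥ 1, β ∈ [0,1), q ∈ ℝ^K a probability vector, and Q[y',y] = (1-β)·𝟙[y'=y] + β·q(y'). Then Q is invertible and the maximum column absolute sum of Q⁻¹ satisfies max_y Σ_{y'} |Q⁻¹[y',y]| ≤ √2·K/(1-β). -/

import Mathlib

open Finset Real

/-- A rank-one mixture of the identity with a probability vector has an explicit inverse, up to the
factor `1 - β`. -/
theorem label_randomization_mul {ι : Type*} [Fintype ι] [DecidableEq ι] (β : ℝ) (q : ι → ℝ)
    (hq : ∑ y, q y = 1) (Q : Matrix ι ι ℝ)
    (hQ : ∀ y' y, Q y' y = (1 - β) * (if y' = y then 1 else 0) + β * q y') :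
    Q * Matrix.of (fun y' y => (if y' = y then 1 else 0) - β * q y') =
      (1 - β) • (1 : Matrix ι ι ℝ) := by
  ext i j
  have hcol : ∑ x, ((if x = j then (1 : ℝ) else 0) - β * q x) = 1 - β := by
    simp [Finset.sum_sub_distrib, ← Finset.mul_sum, hq]
  simp only [Matrix.mul_apply, Matrix.of_apply, hQ, add_mul, Finset.sum_add_distrib,
    ← Finset.mul_sum, hcol, mul_assoc, ite_mul, one_mul, zero_mul, Finset.sum_ite_eq,
    Finset.mem_univ, if_true, Matrix.smul_apply, Matrix.one_apply, smul_eq_mul]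
  ring

/-- The absolute column sums of `1 - β q 1ᵀ` for a probability vector `q`. -/
theorem sum_abs_indicator_sub {ι : Type*} [Fintype ι] [DecidableEq ι] {β : ℝ} (hβ0 : 0 ≤ β)
    (hβ1 : β ≤ 1) {q : ι → ℝ} (hq0 : ∀ y, 0 ≤ q y) (hq1 : ∑ y, q y = 1) (y : ι) :
    ∑ y', |(if y' = y then 1 else 0) - β * q y'| = 1 + β - 2 * β * q y := by
  have hterm : ∀ y', |(if y' = y then 1 else 0) - β * q y'| =
      (if y' = y then 1 - 2 * β * q y else 0) + β * q y' := by
    intro y'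
    split_ifs with h
    · subst h
      have hle : q y' ≤ 1 := hq1 ▸ Finset.single_le_sum (fun i _ => hq0 i) (Finset.mem_univ y')
      rw [abs_of_nonneg (sub_nonneg.2 (mul_le_one₀ hβ1 (hq0 y') hle))]
      ring
    · rw [zero_sub, abs_neg, abs_of_nonneg (mul_nonneg hβ0 (hq0 y')), zero_add]
  simp only [hterm, Finset.sum_add_distrib, ← Finset.mul_sum, hq1, Finset.sum_ite_eq',
    Finset.mem_univ, if_true]
  ring

theorem stmt_1 (K : ℕ) (hK : 1 ≤ K) (β : ℝ) (hβ0 : 0 ≤ β) (hβ1 : β < 1)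
    (q : Fin K → ℝ) (hq0 : ∀ y, 0 ≤ q y) (hq1 : ∑ y, q y = 1)
    (Q : Matrix (Fin K) (Fin K) ℝ)
    (hQ : ∀ y' y, Q y' y = (1 - β) * (if y' = y then 1 else 0) + β * q y') :
    IsUnit Q ∧ ∀ y, ∑ y', |Q⁻¹ y' y| ≤ Real.sqrt 2 * K / (1 - β) := by
  have hpos : 0 < 1 - β := sub_pos.2 hβ1
  have hmul : Q * ((1 - β)⁻¹ • Matrix.of (fun y' y => (if y' = y then 1 else 0) - β * q y')) =
      1 := by
    rw [Matrix.mul_smul, label_randomization_mul β q hq1 Q hQ, smul_smul,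
      inv_mul_cancel₀ hpos.ne', one_smul]
  refine ⟨IsUnit.of_mul_eq_one _ hmul, fun y => ?_⟩
  rw [Matrix.inv_eq_right_inv hmul]
  simp only [Matrix.smul_apply, Matrix.of_apply, smul_eq_mul, abs_mul,
    abs_of_pos (inv_pos.2 hpos), ← Finset.mul_sum]
  rw [sum_abs_indicator_sub hβ0 hβ1.le hq0 hq1, inv_mul_eq_div]
  gcongr
  have hsqrt : 1 ≤ √(2 : ℝ) := Real.one_le_sqrt.2 one_le_two
  obtain rfl | hK2 := hK.eq_or_lt
  · have hy : q y = 1 := by rw [← hq1, Fin.sum_univ_one, Subsingleton.elim y 0]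
    rw [hy, Nat.cast_one]
    linarith
  · have hK2' : (2 : ℝ) ≤ K := by exact_mod_cast hK2
    nlinarith [mul_nonneg hβ0 (hq0 y)]
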